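/- For α ∈ (0,2) and an integer k ≥ 2, let s_α be the symmetric α-stable density with Fourier transform s_α*(x) = exp(−|x|^α), f_{α,k}(x) = s_α(x)^k / ∫ s_α(t)^k dt, and r_{α,k} = 1/f_{α,k}*. Then there is a constant c_{α,k} > 0 such that |r_{α,k}(x)| ≥ c_{α,k} exp( |x|^α / 2^{(k−1)α} ) for all x ∈ ℝ. -/

import Mathlib

open MeasureTheory Filter

noncomputable section

/-- Fourier transform of an integrable function `g : ℝ → ℝ`. -/
def ftC (g : ℝ → ℝ) (w : ℝ) : ℂ :=
  ∫ t : ℝ, Complex.exp (Complex.I * (w : ℂ) * (t : ℂ)) * (g t : ℂ)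

/-- The symmetric `α`-stable density `s_α`, whose Fourier transform is `exp(-|x|^α)`,
obtained by Fourier inversion. -/
def salpha (α : ℝ) (x : ℝ) : ℝ :=
  (1 / (2 * Real.pi)) *
    (∫ t : ℝ, Complex.exp (-(Complex.I * (t : ℂ) * (x : ℂ))) * (Real.exp (-|t| ^ α) : ℂ)).re

/-- The supersmooth density `f_{α,k}(x) = s_α(x)^k / ∫ s_α^k`. -/
def falphak (α : ℝ) (k : ℕ) (x : ℝ) : ℝ :=
  salpha α x ^ k / ∫ t : ℝ, salpha α t ^ k

/-- `r_{α,k} = 1 / f_{α,k}*`. -/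
def rfun (α : ℝ) (k : ℕ) (x : ℝ) : ℂ := 1 / ftC (falphak α k) x

open scoped FourierTransform Topology RealInnerProductSpace Convolution

theorem tendsto_integral_gaussian_mul_fourier {h : ℝ → ℂ} (hc : Continuous h)
    (hi : Integrable h) :
    Tendsto (fun c : ℝ => ∫ w : ℝ, Complex.exp (-(c : ℂ)⁻¹ * (‖w‖ : ℂ) ^ 2) • 𝓕 h w)
      atTop (𝓝 (h 0)) := by
  refine (Real.tendsto_integral_gaussian_smul' hi (hc.continuousAt (x := 0))).congr' ?_
  filter_upwards [Ioi_mem_atTop 0] with c (hc : 0 < c)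
  have hg : Integrable (fun w : ℝ => Complex.exp (-(c : ℂ)⁻¹ * (‖w‖ : ℂ) ^ 2 +
      2 * Real.pi * Complex.I * ⟪(0 : ℝ), w⟫)) :=
    GaussianFourier.integrable_cexp_neg_mul_sq_norm_add (by simpa) _ _
  have key := VectorFourier.integral_fourierIntegral_smul_eq_flip (L := innerₗ ℝ)
      Real.continuous_fourierChar continuous_inner hg hi
  have hflip : (innerₗ ℝ).flip = innerₗ ℝ := by ext; simp
  rw [hflip] at key
  calc _ = ∫ w : ℝ, 𝓕 (fun w : ℝ => Complex.exp (-(c : ℂ)⁻¹ * (‖w‖ : ℂ) ^ 2 +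
      2 * Real.pi * Complex.I * ⟪(0 : ℝ), w⟫)) w • h w := by
        congr with w
        rw [fourier_gaussian_innerProductSpace' (by simpa)]
        congr 2
        · simp
        · congr 1
          simp only [zero_sub, norm_neg, div_inv_eq_mul]
          ring
    _ = _ := key
    _ = _ := by simp; rfl

/-- A continuous integrable function whose Fourier transform is real and nonnegative has an
integrable Fourier transform. -/
theorem integrable_of_fourier_eq_nonneg {h : ℝ → ℂ} {g : ℝ → ℝ} (hc : Continuous h)
    (hi : Integrable h) (hg : ∀ w, 0 ≤ g w) (hgc : Continuous g)
    (hgb : ∃ C, ∀ w, g w ≤ C)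
    (hF : ∀ w, 𝓕 h w = g w) : Integrable g := by
  obtain ⟨C, hC⟩ := hgb
  let G : ℕ → ℝ → ℝ := fun n w => Real.exp (-((n : ℝ) + 1)⁻¹ * w ^ 2) * g w
  have hcast : Tendsto (fun n : ℕ => (n : ℝ) + 1) atTop atTop :=
    tendsto_atTop_add_const_right _ _ tendsto_natCast_atTop_atTop
  have hG : ∀ n, Integrable (G n) := fun n =>
    (integrable_exp_neg_mul_sq (b := ((n : ℝ) + 1)⁻¹) (by positivity)).mul_bdd
      (c := C) hgc.aestronglyMeasurable
      (ae_of_all _ fun w => by rw [Real.norm_of_nonneg (hg w)]; exact hC w)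
  have hlim : Tendsto (fun n => ∫ w, G n w) atTop (𝓝 (h 0).re) := by
    refine ((Complex.continuous_re.tendsto _).comp
      ((tendsto_integral_gaussian_mul_fourier hc hi).comp hcast)).congr fun n => ?_
    have : (fun w : ℝ => Complex.exp (-(((n : ℝ) + 1 : ℝ) : ℂ)⁻¹ * (‖w‖ : ℂ) ^ 2) • 𝓕 h w)
        = fun w => ((G n w : ℝ) : ℂ) := by
      ext w
      rw [hF]
      simp only [G, smul_eq_mul]
      rw [← Complex.ofReal_pow, Real.norm_eq_abs, sq_abs]
      push_cast
      rfl
    simp only [Function.comp_apply]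
    rw [this, integral_complex_ofReal, Complex.ofReal_re]
  refine integrable_of_tendsto (G := G) (ae_of_all _ fun w => ?_)
    (fun n => (hG n).aestronglyMeasurable) ?_
  · have h0 : Tendsto (fun n : ℕ => Real.exp (-((n : ℝ) + 1)⁻¹ * w ^ 2) * g w) atTop
        (𝓝 (Real.exp (-0 * w ^ 2) * g w)) :=
      (Real.continuous_exp.tendsto _ |>.comp
        ((tendsto_inv_atTop_zero.comp hcast).neg.mul_const _)).mul_const _
    simpa [G] using h0
  · have : (fun n => ∫⁻ x, ‖G n x‖ₑ) = fun n => ENNReal.ofReal (∫ w, G n w) := by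
      ext n
      rw [ofReal_integral_eq_lintegral_ofReal (hG n)
        (ae_of_all _ fun w => mul_nonneg (Real.exp_pos _).le (hg w))]
      exact lintegral_congr fun w =>
        Real.enorm_of_nonneg (mul_nonneg (Real.exp_pos _).le (hg w))
    rw [this, (ENNReal.tendsto_ofReal hlim).liminf_eq]
    exact ENNReal.ofReal_ne_top

/-- The function `q_α(x) = exp(-|x|^α)`. -/
def expNegRpow (α x : ℝ) : ℝ := Real.exp (-|x| ^ α)

/-- The convolution of `n + 1` copies of `expNegRpow α`. -/
def expNegRpowConv (α : ℝ) : ℕ → ℝ → ℝ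
  | 0 => expNegRpow α
  | n + 1 => fun x => ∫ t, expNegRpowConv α n t * expNegRpow α (x - t)

section expNegRpow

variable {α : ℝ}

theorem continuous_expNegRpow (hα : 0 < α) : Continuous (expNegRpow α) :=
  Real.continuous_exp.comp
    ((Real.continuous_rpow_const hα.le).comp continuous_abs).neg

theorem expNegRpow_pos (x : ℝ) : 0 < expNegRpow α x := Real.exp_pos _

theorem expNegRpow_le_one (x : ℝ) : expNegRpow α x ≤ 1 :=
  Real.exp_le_one_iff.2 (neg_nonpos.2 (Real.rpow_nonneg (abs_nonneg x) α))

theorem expNegRpow_neg (x : ℝ) : expNegRpow α (-x) = expNegRpow α x := by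
  simp [expNegRpow]

theorem norm_expNegRpow_le (x : ℝ) : ‖expNegRpow α x‖ ≤ 1 := by
  rw [Real.norm_of_nonneg (expNegRpow_pos x).le]; exact expNegRpow_le_one x

theorem integrable_expNegRpow (hα : 0 < α) : Integrable (expNegRpow α) := by
  have h : IntegrableOn (expNegRpow α) (Set.Ioi 0) := by
    refine (integrableOn_rpow_mul_exp_neg_rpow (s := 0) (by norm_num) hα).congr_fun ?_
      measurableSet_Ioi
    intro x hx
    simp [expNegRpow, abs_of_pos (Set.mem_Ioi.1 hx)]
  have h' : IntegrableOn (expNegRpow α) (Set.Iic 0) := by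
    have := Iff.mpr integrableOn_Ici_iff_integrableOn_Ioi h
    rw [← Measure.map_neg_eq_self (volume : Measure ℝ)]
    let m : MeasurableEmbedding fun x : ℝ => -x := (Homeomorph.neg ℝ).measurableEmbedding
    rw [m.integrableOn_map_iff]
    simpa [Function.comp_def, expNegRpow_neg] using this
  rw [← integrableOn_univ, ← Set.Iic_union_Ioi (a := (0 : ℝ))]
  exact h'.union h

theorem ofReal_expNegRpowConv_succ (n : ℕ) :
    (fun x => (expNegRpowConv α (n + 1) x : ℂ)) =
      (fun x => (expNegRpowConv α n x : ℂ)) ⋆[ContinuousLinearMap.mul ℂ ℂ]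
        (fun x => (expNegRpow α x : ℂ)) := by
  ext x
  simp only [expNegRpowConv, convolution_def, ContinuousLinearMap.mul_apply']
  rw [← integral_complex_ofReal]
  simp

theorem integrable_expNegRpowConv (hα : 0 < α) : ∀ n, Integrable (expNegRpowConv α n)
  | 0 => integrable_expNegRpow hα
  | n + 1 => (integrable_expNegRpowConv hα n).integrable_convolution
      (ContinuousLinearMap.mul ℝ ℝ) (integrable_expNegRpow hα)

theorem continuous_expNegRpowConv (hα : 0 < α) : ∀ n, Continuous (expNegRpowConv α n)
  | 0 => continuous_expNegRpow hα
  | n + 1 => BddAbove.continuous_convolution_right_of_integrable (ContinuousLinearMap.mul ℝ ℝ)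
      ⟨1, by rintro _ ⟨x, rfl⟩; exact norm_expNegRpow_le x⟩
      (integrable_expNegRpowConv hα n) (continuous_expNegRpow hα)

theorem integrable_expNegRpowConv_mul (hα : 0 < α) (n : ℕ) (x : ℝ) :
    Integrable fun t => expNegRpowConv α n t * expNegRpow α (x - t) :=
  (integrable_expNegRpowConv hα n).mul_bdd (c := 1)
    ((continuous_expNegRpow hα).comp (continuous_const.sub continuous_id)).aestronglyMeasurable
    (ae_of_all _ fun t => norm_expNegRpow_le (x - t))

theorem expNegRpowConv_pos (hα : 0 < α) : ∀ n x, 0 < expNegRpowConv α n x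
  | 0, x => expNegRpow_pos x
  | n + 1, x => by
    have hpos : ∀ t, 0 < expNegRpowConv α n t * expNegRpow α (x - t) := fun t =>
      mul_pos (expNegRpowConv_pos hα n t) (expNegRpow_pos _)
    refine (integral_pos_iff_support_of_nonneg (fun t => (hpos t).le)
      (integrable_expNegRpowConv_mul hα n x)).2 ?_
    rw [show Function.support _ = Set.univ from Set.eq_univ_of_forall fun t => (hpos t).ne']
    simp

theorem abs_rpow_div_le_of_half_le (hα : 0 < α) {x t : ℝ} (h : |x| / 2 ≤ |t|) :
    |x| ^ α / 2 ^ α ≤ |t| ^ α := by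
  rw [← Real.div_rpow (abs_nonneg x) zero_le_two]
  exact Real.rpow_le_rpow (by positivity) h hα.le

theorem expNegRpowConv_le (hα : 0 < α) (n : ℕ) :
    ∃ C > 0, ∀ x, expNegRpowConv α n x ≤ C * Real.exp (-(|x| ^ α / 2 ^ (n * α))) := by
  induction n with
  | zero => exact ⟨1, one_pos, fun x => by simp [expNegRpowConv, expNegRpow]⟩
  | succ n ih =>
    obtain ⟨C, hC, hb⟩ := ih
    have hint := integrable_expNegRpowConv hα n
    have hq := integrable_expNegRpow hα
    have hpow : (2 : ℝ) ^ (((n + 1 : ℕ) : ℝ) * α) = 2 ^ α * 2 ^ (n * α) := by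
      rw [← Real.rpow_add two_pos]; push_cast; ring_nf
    have h1 : (1 : ℝ) ≤ 2 ^ (n * α) := Real.one_le_rpow one_le_two (by positivity)
    have hnn : ∀ t, 0 ≤ expNegRpowConv α n t := fun t => (expNegRpowConv_pos hα n t).le
    refine ⟨C * (∫ t, expNegRpow α t) + (∫ t, expNegRpowConv α n t) + 1, ?_, fun x => ?_⟩
    · have := integral_nonneg (μ := volume) (f := expNegRpow α) fun t => (expNegRpow_pos t).le
      have := integral_nonneg (μ := volume) (f := expNegRpowConv α n) hnn
      positivity
    set E := Real.exp (-(|x| ^ α / 2 ^ (((n + 1 : ℕ) : ℝ) * α)))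
    have hE : 0 < E := Real.exp_pos _
    have hpt : ∀ t, expNegRpowConv α n t * expNegRpow α (x - t) ≤
        E * (C * expNegRpow α (x - t) + expNegRpowConv α n t) := by
      intro t
      have hqn := (expNegRpow_pos (α := α) (x - t)).le
      rcases le_total (|x| / 2) |t| with h | h
      · have hle : expNegRpowConv α n t ≤ C * E := by
          refine (hb t).trans (mul_le_mul_of_nonneg_left (Real.exp_le_exp.2 (neg_le_neg ?_)) hC.le)
          rw [hpow, ← div_div]
          gcongr
          exact abs_rpow_div_le_of_half_le hα h
        nlinarith [mul_le_mul_of_nonneg_right hle hqn, mul_nonneg hE.le (hnn t)]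
      · have hle : expNegRpow α (x - t) ≤ E := by
          refine Real.exp_le_exp.2 (neg_le_neg ?_)
          rw [hpow, ← div_div]
          have h' : |x| / 2 ≤ |x - t| := by linarith [abs_sub_abs_le_abs_sub x t]
          exact (div_le_self (by positivity) h1).trans (abs_rpow_div_le_of_half_le hα h')
        nlinarith [mul_le_mul_of_nonneg_left hle (hnn t), mul_nonneg (mul_nonneg hE.le hC.le) hqn]
    have hqx : Integrable fun t => expNegRpow α (x - t) := hq.comp_sub_left x
    calc expNegRpowConv α (n + 1) x
        ≤ ∫ t, E * (C * expNegRpow α (x - t) + expNegRpowConv α n t) :=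
          integral_mono (integrable_expNegRpowConv_mul hα n x)
            (((hqx.const_mul C).add hint).const_mul E) hpt
      _ = E * (C * (∫ t, expNegRpow α t) + ∫ t, expNegRpowConv α n t) := by
          rw [integral_const_mul, integral_add (hqx.const_mul C) hint, integral_const_mul,
            integral_sub_left_eq_self (expNegRpow α)]
      _ ≤ _ := by nlinarith

theorem fourier_expNegRpowConv (hα : 0 < α) (n : ℕ) (w : ℝ) :
    𝓕 (fun x => (expNegRpowConv α n x : ℂ)) w = 𝓕 (fun x => (expNegRpow α x : ℂ)) w ^ (n + 1) := by
  induction n with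
  | zero => simp [expNegRpowConv]
  | succ n ih =>
    rw [ofReal_expNegRpowConv_succ, pow_succ _ (n + 1), ← ih]
    exact Real.fourier_mul_convolution_eq (integrable_expNegRpowConv hα n).ofReal
      (integrable_expNegRpow hα).ofReal w

/-- The real part of the Fourier transform of `expNegRpow α`. -/
def expNegRpowFourier (α w : ℝ) : ℝ := (𝓕 (fun x => (expNegRpow α x : ℂ)) w).re

theorem fourier_expNegRpow (w : ℝ) :
    𝓕 (fun x => (expNegRpow α x : ℂ)) w = expNegRpowFourier α w := by
  refine (Complex.conj_eq_iff_re.1 ?_).symm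
  simp only [Real.fourier_real_eq_integral_exp_smul]
  rw [← integral_conj, ← integral_neg_eq_self]
  congr with t
  simp [← Complex.exp_conj, expNegRpow_neg, Complex.conj_ofNat]

theorem continuous_expNegRpowFourier (hα : 0 < α) : Continuous (expNegRpowFourier α) :=
  Complex.continuous_re.comp (VectorFourier.fourierIntegral_continuous
    Real.continuous_fourierChar continuous_inner (integrable_expNegRpow hα).ofReal)

theorem abs_expNegRpowFourier_le (w : ℝ) :
    |expNegRpowFourier α w| ≤ ∫ t, expNegRpow α t := by
  refine (Complex.abs_re_le_norm _).trans ?_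
  refine (VectorFourier.norm_fourierIntegral_le_integral_norm _ _ _ _ _).trans_eq ?_
  congr with t
  rw [Complex.norm_real, Real.norm_of_nonneg (expNegRpow_pos t).le]

theorem integrable_expNegRpowFourier_pow (hα : 0 < α) (n : ℕ) :
    Integrable fun w => expNegRpowFourier α w ^ (n + 2) := by
  have hc := continuous_expNegRpowFourier hα
  have hsq : Integrable fun w => expNegRpowFourier α w ^ 2 := by
    refine integrable_of_fourier_eq_nonneg
      (Complex.continuous_ofReal.comp (continuous_expNegRpowConv hα 1))
      (integrable_expNegRpowConv hα 1).ofReal (fun w => sq_nonneg _) (hc.pow 2)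
      ⟨(∫ t, expNegRpow α t) ^ 2, fun w => ?_⟩ fun w => ?_
    · rw [← sq_abs]
      exact pow_le_pow_left₀ (abs_nonneg _) (abs_expNegRpowFourier_le w) 2
    · refine (fourier_expNegRpowConv hα 1 w).trans ?_
      rw [fourier_expNegRpow]; push_cast; rfl
  refine (hsq.bdd_mul (c := (∫ t, expNegRpow α t) ^ n)
    (hc.pow n).aestronglyMeasurable (ae_of_all _ fun w => ?_)).congr
    (ae_of_all _ fun w => (pow_add _ n 2).symm)
  rw [Pi.pow_apply, norm_pow]
  exact pow_le_pow_left₀ (norm_nonneg _) (abs_expNegRpowFourier_le w) n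

theorem fourierInv_expNegRpowFourier_pow (hα : 0 < α) (n : ℕ) (x : ℝ) :
    𝓕⁻ (fun w => ((expNegRpowFourier α w ^ (n + 2) : ℝ) : ℂ)) x = expNegRpowConv α (n + 1) x := by
  have hF : 𝓕 (fun x => (expNegRpowConv α (n + 1) x : ℂ)) =
      fun w => ((expNegRpowFourier α w ^ (n + 2) : ℝ) : ℂ) := by
    ext w
    rw [fourier_expNegRpowConv hα, fourier_expNegRpow]; push_cast; rfl
  have hint : Integrable (𝓕 fun x => (expNegRpowConv α (n + 1) x : ℂ)) :=
    hF ▸ (integrable_expNegRpowFourier_pow hα n).ofReal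
  rw [← hF]
  exact congrFun (Continuous.fourierInv_fourier_eq
    (Complex.continuous_ofReal.comp (continuous_expNegRpowConv hα (n + 1)))
    (integrable_expNegRpowConv hα (n + 1)).ofReal hint) x

end expNegRpow

theorem salpha_eq (α x : ℝ) :
    salpha α x = (2 * Real.pi)⁻¹ * expNegRpowFourier α (x / (2 * Real.pi)) := by
  rw [salpha, expNegRpowFourier, Real.fourier_real_eq_integral_exp_smul, one_div]
  congr 3 with t
  rw [smul_eq_mul]
  congr 2
  push_cast
  field_simp [Complex.ofReal_ne_zero.2 Real.pi_ne_zero]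

theorem ftC_salpha_pow {α : ℝ} (hα : 0 < α) (n : ℕ) (x : ℝ) :
    ftC (fun t => salpha α t ^ (n + 2)) x =
      ((2 * Real.pi)⁻¹ ^ (n + 1) * expNegRpowConv α (n + 1) x : ℝ) := by
  have hpi : (Real.pi : ℂ) ≠ 0 := Complex.ofReal_ne_zero.2 Real.pi_ne_zero
  have hsub := Measure.integral_comp_div (fun w : ℝ =>
    Complex.exp (↑(2 * Real.pi * inner ℝ w x) * Complex.I) •
      ((expNegRpowFourier α w ^ (n + 2) : ℝ) : ℂ)) (2 * Real.pi)
  rw [← Real.fourierInv_eq', fourierInv_expNegRpowFourier_pow hα, abs_of_pos (by positivity)]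
    at hsub
  calc ftC (fun t => salpha α t ^ (n + 2)) x
      = ∫ t : ℝ, (((2 * Real.pi)⁻¹ ^ (n + 2) : ℝ) : ℂ) *
        (Complex.exp (↑(2 * Real.pi * inner ℝ (t / (2 * Real.pi)) x) * Complex.I) •
          ((expNegRpowFourier α (t / (2 * Real.pi)) ^ (n + 2) : ℝ) : ℂ)) := by
        rw [ftC]
        congr with t
        have harg : Complex.I * (x : ℂ) * (t : ℂ) =
            ↑(2 * Real.pi * inner ℝ (t / (2 * Real.pi)) x) * Complex.I := by
          simp only [RCLike.inner_apply, conj_trivial]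
          push_cast
          field_simp
        rw [salpha_eq, mul_pow, harg, smul_eq_mul]
        push_cast
        ring
    _ = _ := by
        rw [integral_const_mul, hsub, Complex.real_smul, pow_succ _ (n + 1)]
        push_cast
        field_simp

theorem integral_salpha_pow {α : ℝ} (hα : 0 < α) (n : ℕ) :
    ∫ t, salpha α t ^ (n + 2) = (2 * Real.pi)⁻¹ ^ (n + 1) * expNegRpowConv α (n + 1) 0 := by
  have h := ftC_salpha_pow hα n 0
  rw [ftC] at h
  simp only [Complex.ofReal_zero, mul_zero, zero_mul, Complex.exp_zero, one_mul] at h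
  rw [integral_complex_ofReal] at h
  exact_mod_cast h

theorem rfun_eq {α : ℝ} (hα : 0 < α) (n : ℕ) (x : ℝ) :
    rfun α (n + 2) x = (expNegRpowConv α (n + 1) 0 / expNegRpowConv α (n + 1) x : ℝ) := by
  have hpi : (Real.pi : ℂ) ≠ 0 := Complex.ofReal_ne_zero.2 Real.pi_ne_zero
  have h0 : (expNegRpowConv α (n + 1) 0 : ℂ) ≠ 0 :=
    Complex.ofReal_ne_zero.2 (expNegRpowConv_pos hα _ _).ne'
  have hx : (expNegRpowConv α (n + 1) x : ℂ) ≠ 0 :=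
    Complex.ofReal_ne_zero.2 (expNegRpowConv_pos hα _ _).ne'
  have h : ftC (falphak α (n + 2)) x = ftC (fun t => salpha α t ^ (n + 2)) x /
      ((∫ t, salpha α t ^ (n + 2) : ℝ) : ℂ) := by
    simp only [ftC, falphak]
    rw [← integral_div]
    congr with t
    push_cast
    ring
  rw [rfun, h, ftC_salpha_pow hα, integral_salpha_pow hα]
  push_cast
  field_simp

/-- Lower bound `|r_{α,k}(x)| ≥ c_{α,k} exp(|x|^α / 2^{(k-1)α})`. -/
theorem rfun_lower_bound (α : ℝ) (hα : α ∈ Set.Ioo (0 : ℝ) 2) (k : ℕ) (hk : 2 ≤ k) :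
    ∃ c > (0 : ℝ), ∀ x : ℝ,
      c * Real.exp ((|x| ^ α) / 2 ^ (((k : ℝ) - 1) * α)) ≤ ‖rfun α k x‖ := by
  obtain ⟨n, rfl⟩ := Nat.exists_eq_add_of_le' hk
  have h0 := hα.1
  obtain ⟨C, hC, hb⟩ := expNegRpowConv_le h0 (n + 1)
  have hq0 := expNegRpowConv_pos h0 (n + 1) 0
  refine ⟨expNegRpowConv α (n + 1) 0 / C, div_pos hq0 hC, fun x => ?_⟩
  have hqx := expNegRpowConv_pos h0 (n + 1) x
  have hk' : ((n + 2 : ℕ) : ℝ) - 1 = ((n + 1 : ℕ) : ℝ) := by push_cast; ring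
  rw [rfun_eq h0, Complex.norm_real, Real.norm_of_nonneg (div_pos hq0 hqx).le, hk',
    ← neg_neg (|x| ^ α / _), Real.exp_neg, ← div_eq_mul_inv, div_div]
  exact div_le_div_of_nonneg_left hq0.le hqx (hb x)

end
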